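/- For any real number s ≥ 2 and any integer m ≥ 1, setting t = ⌊log₂ s⌋, there exists a constant c > 0 such that for arbitrarily large integers n there exists a set system S on an n-element ground set with f_S(m) ≤ s·m + (s−1) and f_S(n) ≥ c · n^{t+1−(2^{t+1}−t−2)/(s−1)}. -/

import Mathlib

/-- The shatter function of a set system `S` on the finite ground set `X`:
`f_S(m) = max { |{e ∩ Y : e ∈ S}| : Y ⊆ X, |Y| = m }`. -/
def shatter {X : Type*} [DecidableEq X] [Fintype X]
    (S : Finset (Finset X)) (m : ℕ) : ℕ :=
  (Finset.univ.powersetCard m).sup (fun Y => (S.image (· ∩ Y)).card)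

/-- Subsets of `I` with at least two elements. -/
def bigSub {V : Type*} [DecidableEq V] (I : Finset V) : Finset (Finset V) :=
  I.powerset.filter (fun B => 2 ≤ B.card)

theorem card_small {V : Type*} [DecidableEq V] (I : Finset V) :
    (I.powerset.filter (fun B => ¬ 2 ≤ B.card)).card = I.card + 1 := by
  have h : I.powerset.filter (fun B => ¬ 2 ≤ B.card)
      = I.powersetCard 0 ∪ I.powersetCard 1 := by
    ext B
    simp only [Finset.mem_filter, Finset.mem_powerset, Finset.mem_union, Finset.mem_powersetCard]
    constructor
    · rintro ⟨h1, h2⟩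
      have : B.card = 0 ∨ B.card = 1 := by omega
      tauto
    · rintro (⟨h1, h2⟩ | ⟨h1, h2⟩)
      · exact ⟨h1, by omega⟩
      · exact ⟨h1, by omega⟩
  rw [h, Finset.card_union_of_disjoint, Finset.card_powersetCard, Finset.card_powersetCard]
  · simp; omega
  · exact Finset.pairwise_disjoint_powersetCard I (by norm_num)

theorem card_bigSub {V : Type*} [DecidableEq V] (I : Finset V) :
    (bigSub I).card + (I.card + 1) = 2 ^ I.card := by
  rw [← card_small I, bigSub, Finset.card_filter_add_card_filter_not, Finset.card_powerset]

/-- product weight of an outcome -/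
noncomputable def wt {W : Type*} [DecidableEq W] [Fintype W] (p : ℝ) (ω : Finset W) : ℝ :=
  (∏ _i ∈ ω, p) * ∏ _i ∈ Finset.univ \ ω, (1 - p)

theorem sum_wt {W : Type*} [DecidableEq W] [Fintype W] (p : ℝ) (T : Finset W) :
    ∑ ω : Finset W, wt p ω * (if T ⊆ ω then 1 else 0) = p ^ T.card := by
  have h := Finset.prod_add (fun _ : W => p) (fun i => if i ∈ T then 0 else 1 - p) Finset.univ
  have h1 : ∏ i : W, (p + if i ∈ T then 0 else 1 - p) = p ^ T.card := by
    have : ∀ i : W, (p + if i ∈ T then 0 else 1 - p) = if i ∈ T then p else 1 := by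
      intro i; split_ifs <;> ring
    simp_rw [this]
    rw [Finset.prod_ite_mem]
    simp
  rw [← h1, h, Finset.powerset_univ]
  refine Finset.sum_congr rfl fun ω _ => ?_
  rw [wt, mul_assoc]
  congr 1
  split_ifs with hT
  · rw [mul_one]
    refine Finset.prod_congr rfl fun i hi => ?_
    rw [if_neg]
    intro hi'
    exact (Finset.mem_sdiff.1 hi).2 (hT hi')
  · rw [mul_zero]
    obtain ⟨i, hi, hi'⟩ := Finset.not_subset.1 hT
    symm
    exact Finset.prod_eq_zero (i := i) (by simp [hi']) (by simp [hi])

theorem wt_pos {W : Type*} [DecidableEq W] [Fintype W] (p : ℝ) (h0 : 0 < p) (h1 : p < 1)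
    (ω : Finset W) : 0 < wt p ω :=
  mul_pos (Finset.prod_pos fun _ _ => h0) (Finset.prod_pos fun _ _ => by linarith)

/-- the complex of an outcome -/
def cplx {n : ℕ} (ω : Finset (Finset (Fin n))) : Finset (Finset (Fin n)) :=
  Finset.univ.filter (fun A => bigSub A ⊆ ω)

theorem trace_card {n : ℕ} (ω : Finset (Finset (Fin n))) (Y : Finset (Fin n)) :
    ((cplx ω).image (· ∩ Y)).card ≤ (Y.card + 1) + (ω ∩ bigSub Y).card := by
  rw [← card_small Y]
  refine le_trans (Finset.card_le_card ?_) (Finset.card_union_le _ _)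
  intro B hB
  obtain ⟨A, hA, rfl⟩ := Finset.mem_image.1 hB
  simp only [cplx, Finset.mem_filter, Finset.mem_univ, true_and] at hA
  by_cases h : 2 ≤ (A ∩ Y).card
  · refine Finset.mem_union_right _ (Finset.mem_inter.2 ⟨hA ?_, ?_⟩)
    · simp only [bigSub, Finset.mem_filter, Finset.mem_powerset]
      exact ⟨Finset.inter_subset_left, h⟩
    · simp only [bigSub, Finset.mem_filter, Finset.mem_powerset]
      exact ⟨Finset.inter_subset_right, h⟩
  · refine Finset.mem_union_left _ ?_
    simp only [Finset.mem_filter, Finset.mem_powerset]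
    exact ⟨Finset.inter_subset_right, h⟩

theorem shatter_univ_ge {n : ℕ} (S : Finset (Finset (Fin n))) : S.card ≤ shatter S n := by
  have h : (Finset.univ : Finset (Fin n)) ∈ Finset.univ.powersetCard n := by
    simp [Finset.mem_powersetCard]
  have := Finset.le_sup (f := fun Y => (S.image (· ∩ Y)).card) h
  refine le_trans ?_ this
  simp

theorem sum_inter_pow {n : ℕ} (m : ℕ) (A : Finset (Fin n)) :
    ∑ Y ∈ (Finset.univ : Finset (Fin n)).powersetCard m, (n : ℝ) ^ (A ∩ Y).card
      ≤ 2 ^ A.card * (n : ℝ) ^ m := by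
  have hmap : ∀ Y ∈ (Finset.univ : Finset (Fin n)).powersetCard m, A ∩ Y ∈ A.powerset :=
    fun Y _ => Finset.mem_powerset.2 Finset.inter_subset_left
  rw [← Finset.sum_fiberwise_of_maps_to hmap]
  have : (2 : ℝ) ^ A.card * (n : ℝ) ^ m = ∑ _I ∈ A.powerset, (n : ℝ) ^ m := by
    rw [Finset.sum_const, Finset.card_powerset, nsmul_eq_mul]; push_cast; rfl
  rw [this]
  refine Finset.sum_le_sum fun I hI => ?_
  set Q := (Finset.univ.powersetCard m).filter (fun Y => A ∩ Y = I) with hQ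
  have e : ∑ Y ∈ Q, (n : ℝ) ^ (A ∩ Y).card = ∑ Y ∈ Q, (n : ℝ) ^ I.card :=
    Finset.sum_congr rfl fun Y hY => by rw [(Finset.mem_filter.1 hY).2]
  rw [e, Finset.sum_const, nsmul_eq_mul]
  rcases Q.eq_empty_or_nonempty with h0 | ⟨Y0, hY0⟩
  · rw [h0]; simp
  have hIm : I.card ≤ m := by
    obtain ⟨h1, h2⟩ := Finset.mem_filter.1 hY0
    rw [← (Finset.mem_powersetCard.1 h1).2, ← h2]
    exact Finset.card_le_card Finset.inter_subset_right
  have hc : Q.card ≤ ((Finset.univ : Finset (Fin n)).powersetCard (m - I.card)).card := by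
    refine Finset.card_le_card_of_injOn (fun Y => Y \ A) ?_ ?_
    · intro Y hY
      obtain ⟨h1, h2⟩ := Finset.mem_filter.1 hY
      have h3 := (Finset.mem_powersetCard.1 h1).2
      have h4 := Finset.card_sdiff_add_card_inter Y A
      rw [Finset.inter_comm, h2] at h4
      rw [Finset.mem_coe, Finset.mem_powersetCard]
      exact ⟨Finset.subset_univ _, by show (Y \ A).card = _; omega⟩
    · intro Y hY Z hZ h
      have h2 := (Finset.mem_filter.1 hY).2
      have h3 := (Finset.mem_filter.1 hZ).2
      simp only at h
      rw [← Finset.sdiff_union_inter Y A, ← Finset.sdiff_union_inter Z A, h,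
        Finset.inter_comm Y, Finset.inter_comm Z, h2, h3]
  rw [Finset.card_powersetCard, Finset.card_univ, Fintype.card_fin] at hc
  have hc' : (Q.card : ℝ) ≤ (n : ℝ) ^ (m - I.card) := by
    exact_mod_cast hc.trans (Nat.choose_le_pow _ _)
  calc (Q.card : ℝ) * (n : ℝ) ^ I.card ≤ (n : ℝ) ^ (m - I.card) * (n : ℝ) ^ I.card := by gcongr
    _ = (n : ℝ) ^ m := by rw [← pow_add]; congr 1; omega

/-- The averaging argument. -/
theorem averaging (n m t F D : ℕ) (p : ℝ) (hp0 : 0 < p) (hp1 : p < 1)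
    (hD : D + (t + 1 + 1) = 2 ^ (t + 1))
    (hg : ∀ i ≤ t + 1, ∀ g : ℕ, g + (i + 1) = 2 ^ i → 1 ≤ p ^ g * (n : ℝ) ^ i)
    (hsmall : 2 ^ 2 ^ m * 2 ^ (t + 1) * (n : ℝ) ^ m * p ^ F ≤ 1 / 2)
    (hn : t + 1 ≤ n) :
    ∃ ω : Finset (Finset (Fin n)),
      (∀ Y : Finset (Fin n), Y.card = m → (ω ∩ bigSub Y).card < F) ∧
      1 / 2 * ((n.choose (t + 1) : ℝ) * p ^ D) ≤ ((cplx ω).card : ℝ) := by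
  let ind : Finset (Finset (Fin n)) → Finset (Finset (Fin n)) → ℝ :=
    fun T ω => if T ⊆ ω then 1 else 0
  let As := (Finset.univ : Finset (Fin n)).powersetCard (t + 1)
  let Ys := (Finset.univ : Finset (Fin n)).powersetCard m
  let X : Finset (Finset (Fin n)) → ℝ := fun ω => ∑ A ∈ As, ind (bigSub A) ω
  let B : Finset (Finset (Fin n)) → ℝ :=
    fun ω => ∑ Y ∈ Ys, ∑ T ∈ (bigSub Y).powersetCard F, ind T ω
  have hind0 : ∀ T ω, 0 ≤ ind T ω := by
    intro T ω; simp only [ind]; split_ifs <;> norm_num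
  have hcardA : ∀ A ∈ As, (bigSub A).card = D := by
    intro A hA
    have h1 := (Finset.mem_powersetCard.1 hA).2
    have h2 := card_bigSub A
    rw [h1] at h2; omega
  have hEX : ∑ ω, wt p ω * X ω = (n.choose (t + 1) : ℝ) * p ^ D := by
    simp only [X, Finset.mul_sum]
    rw [Finset.sum_comm]
    have : ∀ A ∈ As, ∑ ω, wt p ω * ind (bigSub A) ω = p ^ D := by
      intro A hA
      rw [← hcardA A hA]; exact sum_wt p (bigSub A)
    rw [Finset.sum_congr rfl this, Finset.sum_const, nsmul_eq_mul]
    simp [As]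
  have hone : ∑ ω : Finset (Finset (Fin n)), wt p ω = 1 := by
    have := sum_wt (W := Finset (Fin n)) p ∅
    simpa using this
  have hmulind : ∀ T T' ω, ind T ω * ind T' ω = ind (T ∪ T') ω := by
    intro T T' ω
    simp only [ind, Finset.union_subset_iff]
    split_ifs <;> simp_all
  have hterm : ∀ A ∈ As, ∀ Y ∈ Ys, ∀ T ∈ (bigSub Y).powersetCard F,
      ∑ ω, wt p ω * ind (bigSub A ∪ T) ω ≤ p ^ D * p ^ F * (n : ℝ) ^ (A ∩ Y).card := by
    intro A hA Y hY T hT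
    obtain ⟨hTY, hTF⟩ := Finset.mem_powersetCard.1 hT
    have e : ∑ ω, wt p ω * ind (bigSub A ∪ T) ω = p ^ (bigSub A ∪ T).card := sum_wt p _
    rw [e]
    have hi : (bigSub A ∩ T).card ≤ (bigSub (A ∩ Y)).card := by
      refine Finset.card_le_card fun Z hZ => ?_
      obtain ⟨h1, h2⟩ := Finset.mem_inter.1 hZ
      have h3 := hTY h2
      simp only [bigSub, Finset.mem_filter, Finset.mem_powerset] at h1 h3 ⊢
      exact ⟨Finset.subset_inter h1.1 h3.1, h1.2⟩
    have hu := Finset.card_union_add_card_inter (bigSub A) T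
    rw [hcardA A hA, hTF] at hu
    have hle : (A ∩ Y).card ≤ t + 1 := by
      rw [← (Finset.mem_powersetCard.1 hA).2]
      exact Finset.card_le_card Finset.inter_subset_left
    have h1 := hg _ hle _ (card_bigSub (A ∩ Y))
    calc p ^ (bigSub A ∪ T).card
        ≤ p ^ (bigSub A ∪ T).card * (p ^ (bigSub (A ∩ Y)).card * (n : ℝ) ^ (A ∩ Y).card) :=
          le_mul_of_one_le_right (by positivity) h1
      _ = p ^ ((bigSub A ∪ T).card + (bigSub (A ∩ Y)).card) * (n : ℝ) ^ (A ∩ Y).card := by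
          rw [pow_add]; ring
      _ ≤ p ^ (D + F) * (n : ℝ) ^ (A ∩ Y).card := by
          gcongr ?_ * _
          exact pow_le_pow_of_le_one hp0.le hp1.le (by omega)
      _ = _ := by rw [pow_add]
  have hEXB : ∑ ω, wt p ω * (X ω * B ω) ≤ 1 / 2 * ((n.choose (t + 1) : ℝ) * p ^ D) := by
    have e1 : ∑ ω, wt p ω * (X ω * B ω) = ∑ A ∈ As, ∑ Y ∈ Ys,
        ∑ T ∈ (bigSub Y).powersetCard F, ∑ ω, wt p ω * ind (bigSub A ∪ T) ω := by
      have : ∀ ω, wt p ω * (X ω * B ω) = ∑ A ∈ As, ∑ Y ∈ Ys,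
        ∑ T ∈ (bigSub Y).powersetCard F, wt p ω * ind (bigSub A ∪ T) ω := by
        intro ω
        simp only [X]
        rw [Finset.sum_mul, Finset.mul_sum]
        refine Finset.sum_congr rfl fun A _ => ?_
        simp only [B, Finset.mul_sum, hmulind]
      simp_rw [this]
      rw [Finset.sum_comm]
      refine Finset.sum_congr rfl fun A _ => ?_
      rw [Finset.sum_comm]
      refine Finset.sum_congr rfl fun Y _ => ?_
      rw [Finset.sum_comm]
    rw [e1]
    have e2 : ∀ A ∈ As, ∑ Y ∈ Ys, ∑ T ∈ (bigSub Y).powersetCard F,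
        ∑ ω, wt p ω * ind (bigSub A ∪ T) ω ≤ 1 / 2 * p ^ D := by
      intro A hA
      calc _ ≤ ∑ Y ∈ Ys, (2 ^ 2 ^ m * (p ^ D * p ^ F)) * (n : ℝ) ^ (A ∩ Y).card := by
            refine Finset.sum_le_sum fun Y hY => ?_
            refine (Finset.sum_le_sum (hterm A hA Y hY)).trans ?_
            rw [Finset.sum_const, nsmul_eq_mul]
            have hc : ((bigSub Y).powersetCard F).card ≤ 2 ^ 2 ^ m := by
              rw [Finset.card_powersetCard]
              refine (Nat.choose_le_two_pow _ _).trans (Nat.pow_le_pow_right (by norm_num) ?_)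
              have := card_bigSub Y
              rw [(Finset.mem_powersetCard.1 hY).2] at this
              omega
            have hc' : (((bigSub Y).powersetCard F).card : ℝ) ≤ 2 ^ 2 ^ m := by exact_mod_cast hc
            rw [mul_assoc (2 ^ 2 ^ m : ℝ)]
            gcongr
        _ = (2 ^ 2 ^ m * (p ^ D * p ^ F)) * ∑ Y ∈ Ys, (n : ℝ) ^ (A ∩ Y).card := by
            rw [Finset.mul_sum]
        _ ≤ (2 ^ 2 ^ m * (p ^ D * p ^ F)) * (2 ^ (t + 1) * (n : ℝ) ^ m) := by
            have := sum_inter_pow m A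
            rw [(Finset.mem_powersetCard.1 hA).2] at this
            gcongr
        _ = (2 ^ 2 ^ m * 2 ^ (t + 1) * (n : ℝ) ^ m * p ^ F) * p ^ D := by ring
        _ ≤ 1 / 2 * p ^ D := by gcongr
    refine (Finset.sum_le_sum e2).trans (le_of_eq ?_)
    rw [Finset.sum_const, nsmul_eq_mul]
    simp [As]; ring
  have hex : ∃ ω ∈ (Finset.univ : Finset (Finset (Finset (Fin n)))),
      wt p ω * (1 / 2 * ((n.choose (t + 1) : ℝ) * p ^ D)) ≤ wt p ω * (X ω - X ω * B ω) := by
    refine Finset.exists_le_of_sum_le Finset.univ_nonempty ?_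
    rw [← Finset.sum_mul, hone]
    simp only [mul_sub, Finset.sum_sub_distrib]
    rw [hEX]
    linarith
  obtain ⟨ω, -, hω⟩ := hex
  have hω' := le_of_mul_le_mul_left hω (wt_pos p hp0 hp1 ω)
  have hK : 0 < 1 / 2 * ((n.choose (t + 1) : ℝ) * p ^ D) := by
    have : 0 < n.choose (t + 1) := Nat.choose_pos hn
    positivity
  have hX0 : 0 ≤ X ω := Finset.sum_nonneg fun A _ => hind0 _ _
  have hB0 : 0 ≤ B ω := Finset.sum_nonneg fun Y _ => Finset.sum_nonneg fun T _ => hind0 _ _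
  refine ⟨ω, ?_, ?_⟩
  · intro Y hY
    by_contra hcon
    push Not at hcon
    obtain ⟨T, hT, hTc⟩ := Finset.exists_subset_card_eq hcon
    have h1 : 1 ≤ B ω := by
      have hTω : ind T ω = 1 := if_pos (hT.trans Finset.inter_subset_left)
      have hTm : T ∈ (bigSub Y).powersetCard F :=
        Finset.mem_powersetCard.2 ⟨hT.trans Finset.inter_subset_right, hTc⟩
      have hYm : Y ∈ Ys := Finset.mem_powersetCard.2 ⟨Finset.subset_univ _, hY⟩
      calc (1 : ℝ) = ind T ω := hTω.symm
        _ ≤ ∑ T ∈ (bigSub Y).powersetCard F, ind T ω :=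
          Finset.single_le_sum (f := fun T => ind T ω) (fun T _ => hind0 T ω) hTm
        _ ≤ B ω := Finset.single_le_sum
          (f := fun Y => ∑ T ∈ (bigSub Y).powersetCard F, ind T ω)
          (fun Y _ => Finset.sum_nonneg fun T _ => hind0 T ω) hYm
    nlinarith
  · have hXc : X ω ≤ ((cplx ω).card : ℝ) := by
      simp only [X, ind]
      rw [Finset.sum_boole]
      exact_mod_cast Finset.card_le_card
        (Finset.filter_subset_filter _ (Finset.subset_univ _))
    nlinarith [mul_nonneg hX0 hB0]

theorem random_complex_shatter (s : ℝ) (hs : 2 ≤ s) (m : ℕ) (hm : 1 ≤ m)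
    (t : ℕ) (ht : (t : ℤ) = ⌊Real.logb 2 s⌋) :
    ∃ c : ℝ, 0 < c ∧ ∀ n₀ : ℕ, ∃ n : ℕ, n₀ ≤ n ∧
      ∃ S : Finset (Finset (Fin n)),
        (shatter S m : ℝ) ≤ s * m + (s - 1) ∧
        c * (n : ℝ) ^ ((t : ℝ) + 1 - ((2 : ℝ) ^ (t + 1) - t - 2) / (s - 1)) ≤
          (shatter S n : ℝ) := by
  have h2t : (2 : ℝ) ^ t ≤ s := by
    have h1 : (t : ℝ) ≤ Real.logb 2 s := by
      have := Int.floor_le (Real.logb 2 s)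
      rw [← ht] at this
      exact_mod_cast this
    rw [Real.le_logb_iff_rpow_le (by norm_num) (by linarith), Real.rpow_natCast] at h1
    exact h1
  have hs1 : 0 < s - 1 := by linarith
  obtain ⟨D, hD⟩ : ∃ D : ℕ, D + (t + 1 + 1) = 2 ^ (t + 1) := by
    have : t + 1 < 2 ^ (t + 1) := Nat.lt_two_pow_self
    exact ⟨2 ^ (t + 1) - (t + 1 + 1), by omega⟩
  have hDr : (D : ℝ) = (2 : ℝ) ^ (t + 1) - t - 2 := by
    have : (D : ℝ) + (t + 1 + 1) = 2 ^ (t + 1) := by exact_mod_cast hD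
    linarith
  have hz : 0 ≤ (s - 1) * (m + 1) - 1 := by
    have : (0 : ℝ) ≤ m := by positivity
    nlinarith
  set F : ℕ := ⌊(s - 1) * (m + 1) - 1⌋₊ + 1 with hF
  have hFlt : (s - 1) * (m + 1) - 1 < F := by
    rw [hF]; push_cast; exact Nat.lt_floor_add_one _
  have hFle : (F : ℝ) - 1 ≤ (s - 1) * (m + 1) - 1 := by
    rw [hF]; push_cast; linarith [Nat.floor_le hz]
  have hδ : 0 < F / (s - 1) - m := by
    rw [sub_pos, lt_div_iff₀ hs1]; nlinarith
  refine ⟨1 / (2 ^ (t + 2) * (t + 1).factorial), by positivity, fun n₀ => ?_⟩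
  have hlim : Filter.Tendsto (fun n : ℕ => 2 ^ 2 ^ m * 2 ^ (t + 1) *
      ((n : ℝ) ^ (-(F / (s - 1) - m)))) Filter.atTop (nhds 0) := by
    have := ((tendsto_rpow_neg_atTop hδ).comp tendsto_natCast_atTop_atTop).const_mul
      ((2 : ℝ) ^ 2 ^ m * 2 ^ (t + 1))
    simpa using this
  have hev := (hlim.eventually (ge_mem_nhds (show (0 : ℝ) < 1 / 2 by norm_num))).and
    (Filter.eventually_ge_atTop (max n₀ (2 * (t + 1))))
  obtain ⟨n, hn1, hn2⟩ := hev.exists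
  have hn0 : n₀ ≤ n := le_trans (le_max_left _ _) hn2
  have hnt : 2 * (t + 1) ≤ n := le_trans (le_max_right _ _) hn2
  refine ⟨n, hn0, ?_⟩
  have hnpos : (0 : ℝ) < n := by
    have : 0 < n := by omega
    exact_mod_cast this
  have hn1' : (1 : ℝ) < n := by
    have : 1 < n := by omega
    exact_mod_cast this
  set p : ℝ := (n : ℝ) ^ (-(1 / (s - 1))) with hp
  have hp0 : 0 < p := Real.rpow_pos_of_pos hnpos _
  have hp1 : p < 1 := Real.rpow_lt_one_of_one_lt_of_neg hn1' (by
    have : 0 < 1 / (s - 1) := by positivity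
    linarith)
  have hpk : ∀ k : ℕ, p ^ k = (n : ℝ) ^ (-(k / (s - 1))) := by
    intro k
    rw [hp, ← Real.rpow_natCast, ← Real.rpow_mul hnpos.le]
    congr 1; ring
  have hg : ∀ i ≤ t + 1, ∀ g : ℕ, g + (i + 1) = 2 ^ i → 1 ≤ p ^ g * (n : ℝ) ^ i := by
    intro i hi g hgi
    rw [hpk, ← Real.rpow_natCast (n : ℝ) i, ← Real.rpow_add hnpos]
    refine Real.one_le_rpow hn1'.le ?_
    have : (g : ℝ) / (s - 1) ≤ i := by
      rw [div_le_iff₀ hs1]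
      have hgr : (g : ℝ) + (i + 1) = 2 ^ i := by exact_mod_cast hgi
      rcases Nat.lt_or_ge i 2 with h | h
      · interval_cases i
        · norm_num at hgr ⊢; linarith
        · have hg0 : g = 0 := by omega
          rw [hg0]; push_cast; linarith
      · have h1 : (2 : ℝ) ^ i ≤ 2 ^ (t + 1) := pow_le_pow_right₀ (by norm_num) hi
        rw [pow_succ] at h1
        have h2 : (2 : ℝ) ≤ i := by exact_mod_cast h
        nlinarith
    linarith
  have hsmall : 2 ^ 2 ^ m * 2 ^ (t + 1) * (n : ℝ) ^ m * p ^ F ≤ 1 / 2 := by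
    refine le_trans (le_of_eq ?_) hn1
    rw [hpk, mul_assoc, ← Real.rpow_natCast (n : ℝ) m, ← Real.rpow_add hnpos]
    congr 2; ring
  obtain ⟨ω, hω1, hω2⟩ := averaging n m t F D p hp0 hp1 hD hg hsmall (by omega)
  refine ⟨cplx ω, ?_, ?_⟩
  · have h1 : shatter (cplx ω) m ≤ m + F := by
      refine Finset.sup_le fun Y hY => ?_
      have hYm := (Finset.mem_powersetCard.1 hY).2
      have h2 := trace_card ω Y
      have h3 := hω1 Y hYm
      rw [hYm] at h2
      omega
    have h1' : (shatter (cplx ω) m : ℝ) ≤ m + F := by exact_mod_cast h1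
    linarith
  · have h1 : ((cplx ω).card : ℝ) ≤ shatter (cplx ω) n := by
      exact_mod_cast shatter_univ_ge (cplx ω)
    refine le_trans ?_ (hω2.trans h1)
    have hch : ((n : ℝ) / 2) ^ (t + 1) / (t + 1).factorial ≤ (n.choose (t + 1) : ℝ) := by
      have h := Nat.pow_le_choose (α := ℝ) (t + 1) n
      refine le_trans ?_ h
      have : (n : ℝ) / 2 ≤ ((n + 1 - (t + 1) : ℕ) : ℝ) := by
        have h3 : (n : ℝ) ≤ 2 * ((n + 1 - (t + 1) : ℕ) : ℝ) := by
          exact_mod_cast (by omega : n ≤ 2 * (n + 1 - (t + 1)))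
        linarith
      push_cast at this ⊢
      gcongr
    have he : (n : ℝ) ^ ((t : ℝ) + 1 - ((2 : ℝ) ^ (t + 1) - t - 2) / (s - 1))
        = (n : ℝ) ^ (t + 1) * p ^ D := by
      rw [hpk, ← hDr, ← Real.rpow_natCast (n : ℝ) (t + 1), ← Real.rpow_add hnpos]
      congr 1; push_cast; ring
    rw [he]
    calc _ = 1 / 2 * (((n : ℝ) / 2) ^ (t + 1) / (t + 1).factorial * p ^ D) := by
          rw [div_pow, pow_succ 2 (t + 1)]
          field_simp
      _ ≤ _ := by gcongr
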